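/- In the setting of the regularized TD fixed point: let X be a real n × K matrix with linearly independent columns, D an n × n diagonal matrix with positive diagonal entries summing to 1, P an n × n row-stochastic matrix, r ∈ ℝⁿ, γ ∈ [0, 1), η > 0, ξ ∈ (0, 1), and suppose γ ‖X‖ ‖P‖_D ≤ 2(1 − ξ)√η where ‖P‖_D := ‖D^{1/2} P D^{−1/2}‖. Then the unique fixed point w*_η of f(θ) = (Xᵀ D X + η I)⁻¹ Xᵀ D (r + γ P X θ) satisfies ‖w*_η‖ ≤ ‖r‖ / (2 ξ √η). -/

import Mathlib

open Matrix

/-- The operator norm of a real matrix induced by the Euclidean norms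
(i.e., its largest singular value). -/
noncomputable def opNorm {m n : Type*} [Fintype m] [Fintype n] [DecidableEq n]
    (M : Matrix m n ℝ) : ℝ :=
  ‖LinearMap.toContinuousLinearMap (Matrix.toEuclideanLin M)‖

/-- The Euclidean norm of a plain vector. -/
noncomputable def evnorm {n : Type*} [Fintype n] (v : n → ℝ) : ℝ :=
  ‖(WithLp.equiv 2 (n → ℝ)).symm v‖

lemma le_of_sq_le_sq_aux {a b : ℝ} (h : a ^ 2 ≤ b ^ 2) (hb : 0 ≤ b) : a ≤ b :=
  (le_abs_self a).trans (abs_le_of_sq_le_sq h hb)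

lemma evnorm_sq {m : Type*} [Fintype m] (v : m → ℝ) : evnorm v ^ 2 = v ⬝ᵥ v := by
  unfold evnorm
  rw [EuclideanSpace.norm_sq_eq]
  simp [dotProduct, sq]

lemma evnorm_nonneg {m : Type*} [Fintype m] (v : m → ℝ) : 0 ≤ evnorm v := norm_nonneg _

lemma evnorm_add_le {m : Type*} [Fintype m] (v w : m → ℝ) :
    evnorm (v + w) ≤ evnorm v + evnorm w := norm_add_le (WithLp.toLp 2 v) (WithLp.toLp 2 w)

lemma evnorm_smul {m : Type*} [Fintype m] (c : ℝ) (v : m → ℝ) :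
    evnorm (c • v) = |c| * evnorm v := norm_smul c (WithLp.toLp 2 v)

lemma evnorm_eq_zero {m : Type*} [Fintype m] {v : m → ℝ} (h : evnorm v = 0) : v = 0 := by
  have h2 := evnorm_sq v
  rw [h] at h2
  exact dotProduct_self_eq_zero.mp (by rw [← h2]; norm_num)

lemma evnorm_mulVec_le {m k : Type*} [Fintype m] [Fintype k] [DecidableEq k]
    (M : Matrix m k ℝ) (v : k → ℝ) : evnorm (M *ᵥ v) ≤ opNorm M * evnorm v :=
  (LinearMap.toContinuousLinearMap (Matrix.toEuclideanLin M)).le_opNorm (WithLp.toLp 2 v)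

lemma dot_le_evnorm {m : Type*} [Fintype m] (v w : m → ℝ) :
    v ⬝ᵥ w ≤ evnorm v * evnorm w := by
  have h := real_inner_le_norm (WithLp.toLp 2 v) (WithLp.toLp 2 w)
  rw [EuclideanSpace.inner_toLp_toLp] at h
  simpa [evnorm, dotProduct_comm] using h

lemma evnorm_diag_sqrt_le {m : Type*} [Fintype m] [DecidableEq m] (d : m → ℝ)
    (h0 : ∀ i, 0 < d i) (h1 : ∀ i, d i ≤ 1) (v : m → ℝ) :
    evnorm (diagonal (fun i => Real.sqrt (d i)) *ᵥ v) ≤ evnorm v := by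
  refine le_of_sq_le_sq_aux ?_ (evnorm_nonneg v)
  rw [evnorm_sq, evnorm_sq]
  unfold dotProduct
  apply Finset.sum_le_sum
  intro i _
  rw [mulVec_diagonal]
  have := Real.mul_self_sqrt (h0 i).le
  nlinarith [h1 i, mul_self_nonneg (v i)]

lemma core {n K : ℕ} (X : Matrix (Fin n) (Fin K) ℝ) (d : Fin n → ℝ) (hd : ∀ i, 0 < d i)
    {η : ℝ} (hη : 0 < η) (v : Fin n → ℝ) :
    evnorm ((Xᵀ * diagonal d * X + η • (1 : Matrix (Fin K) (Fin K) ℝ))⁻¹ *ᵥ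
      ((Xᵀ * diagonal d) *ᵥ v)) ≤
      evnorm (diagonal (fun i => Real.sqrt (d i)) *ᵥ v) / (2 * Real.sqrt η) := by
  set A := Xᵀ * diagonal d * X + η • (1 : Matrix (Fin K) (Fin K) ℝ) with hA
  set S := diagonal (fun i => Real.sqrt (d i)) with hS
  have hSS : diagonal d = Sᵀ * S := by
    rw [hS, diagonal_transpose, diagonal_mul_diagonal]
    congr 1; ext i; exact (Real.mul_self_sqrt (hd i).le).symm
  have hs : 0 < Real.sqrt η := Real.sqrt_pos.mpr hη
  by_cases hu : IsUnit A.det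
  swap
  · rw [nonsing_inv_apply_not_isUnit _ hu, zero_mulVec]
    have : evnorm (0 : Fin K → ℝ) = 0 := by simp [evnorm]
    rw [this]
    have := evnorm_nonneg (S *ᵥ v)
    positivity
  set u := A⁻¹ *ᵥ ((Xᵀ * diagonal d) *ᵥ v) with hu'
  have hAu : A *ᵥ u = (Xᵀ * diagonal d) *ᵥ v := by
    rw [hu', mulVec_mulVec, mul_nonsing_inv _ hu, one_mulVec]
  have h1 : u ⬝ᵥ (A *ᵥ u) = evnorm (S *ᵥ X *ᵥ u) ^ 2 + η * evnorm u ^ 2 := by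
    rw [evnorm_sq, evnorm_sq, hA, add_mulVec, dotProduct_add, smul_mulVec, one_mulVec,
      dotProduct_smul, hSS, smul_eq_mul]
    congr 1
    simp only [← mulVec_mulVec, dotProduct_mulVec, vecMul_transpose]
  have h2 : u ⬝ᵥ ((Xᵀ * diagonal d) *ᵥ v) = (S *ᵥ X *ᵥ u) ⬝ᵥ (S *ᵥ v) := by
    rw [hSS]
    simp only [← mulVec_mulVec, dotProduct_mulVec, vecMul_transpose]
  have h3 := dot_le_evnorm (S *ᵥ X *ᵥ u) (S *ᵥ v)
  rw [← h2, ← hAu, h1] at h3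
  rw [le_div_iff₀ (by positivity)]
  refine le_of_sq_le_sq_aux ?_ (evnorm_nonneg _)
  have := Real.sq_sqrt hη.le
  have e : (evnorm u * (2 * Real.sqrt η)) ^ 2 = 4 * (η * evnorm u ^ 2) := by
    rw [mul_pow, mul_pow, this]; ring
  rw [e]
  nlinarith [sq_nonneg (2 * evnorm (S *ᵥ X *ᵥ u) - evnorm (S *ᵥ v))]

/-- under `γ‖X‖‖P‖_D ≤ 2(1 − ξ)√η`, the regularized TD operator
`f(θ) = (XᵀDX + ηI)⁻¹XᵀD(r + γPXθ)` has a unique fixed point `w*_η`, and it satisfies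
`‖w*_η‖ ≤ ‖r‖/(2ξ√η)`. -/
theorem regularized_td_fixed_point_norm_bound {n K : ℕ}
    (X : Matrix (Fin n) (Fin K) ℝ)
    (hX : LinearIndependent ℝ (fun j : Fin K => fun i : Fin n => X i j))
    (d : Fin n → ℝ) (hd : ∀ i, 0 < d i) (hdsum : ∑ i, d i = 1)
    (P : Matrix (Fin n) (Fin n) ℝ) (hP0 : ∀ i j, 0 ≤ P i j) (hP1 : ∀ i, ∑ j, P i j = 1)
    (r : Fin n → ℝ) {γ η ξ : ℝ} (hγ0 : 0 ≤ γ) (hγ1 : γ < 1) (hη : 0 < η)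
    (hξ0 : 0 < ξ) (hξ1 : ξ < 1)
    (D : Matrix (Fin n) (Fin n) ℝ) (hD : D = Matrix.diagonal d)
    (normPD : ℝ)
    (hPD : normPD = opNorm (Matrix.diagonal (fun i => Real.sqrt (d i)) * P *
      Matrix.diagonal fun i => (Real.sqrt (d i))⁻¹))
    (hcond : γ * opNorm X * normPD ≤ 2 * (1 - ξ) * Real.sqrt η)
    (f : (Fin K → ℝ) → Fin K → ℝ)
    (hf : ∀ θ, f θ = (Xᵀ * D * X + η • (1 : Matrix (Fin K) (Fin K) ℝ))⁻¹.mulVec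
      ((Xᵀ * D).mulVec (r + γ • P.mulVec (X.mulVec θ)))) :
    (∃! w, f w = w) ∧
      ∀ w, f w = w → evnorm w ≤ evnorm r / (2 * ξ * Real.sqrt η) := by
  subst hD
  have hd1 : ∀ i, d i ≤ 1 := fun i => by
    rw [← hdsum]
    exact Finset.single_le_sum (fun j _ => (hd j).le) (Finset.mem_univ i)
  have hs : 0 < Real.sqrt η := Real.sqrt_pos.mpr hη
  set A := Xᵀ * diagonal d * X + η • (1 : Matrix (Fin K) (Fin K) ℝ) with hA
  set S := diagonal (fun i => Real.sqrt (d i)) with hS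
  set T := diagonal (fun i => (Real.sqrt (d i))⁻¹) with hT
  have hTS : T * S = 1 := by
    rw [hT, hS, diagonal_mul_diagonal, ← diagonal_one]
    congr 1; ext i; exact inv_mul_cancel₀ (Real.sqrt_pos.mpr (hd i)).ne'
  let L : (Fin K → ℝ) →ₗ[ℝ] (Fin K → ℝ) :=
    γ • (Matrix.mulVecLin (A⁻¹ * (Xᵀ * diagonal d) * P * X))
  have hL : ∀ θ, L θ = A⁻¹ *ᵥ ((Xᵀ * diagonal d) *ᵥ (γ • P *ᵥ (X *ᵥ θ))) := by
    intro θ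
    simp only [L, LinearMap.smul_apply, mulVecLin_apply, mulVec_smul, mulVec_mulVec,
      Matrix.mul_assoc]
  set c := A⁻¹ *ᵥ ((Xᵀ * diagonal d) *ᵥ r) with hc
  have hfL : ∀ θ, f θ = c + L θ := by
    intro θ
    rw [hf, hL, hc, mulVec_add, mulVec_add]
  have hLb : ∀ θ, evnorm (L θ) ≤ (1 - ξ) * evnorm θ := by
    intro θ
    rw [hL]
    refine (core X d hd hη _).trans ?_
    rw [div_le_iff₀ (by positivity), mulVec_smul, evnorm_smul, abs_of_nonneg hγ0]
    have e1 : S *ᵥ P *ᵥ X *ᵥ θ = (S * P * T) *ᵥ (S *ᵥ X *ᵥ θ) := by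
      rw [mulVec_mulVec _ (S * P * T) S, Matrix.mul_assoc (S * P), hTS, Matrix.mul_one,
        mulVec_mulVec _ S P]
    have h1 := evnorm_mulVec_le (S * P * T) (S *ᵥ X *ᵥ θ)
    rw [← e1, ← hPD] at h1
    have h2 := (evnorm_diag_sqrt_le d hd hd1 (X *ᵥ θ)).trans (evnorm_mulVec_le X θ)
    have hN : 0 ≤ normPD := by rw [hPD]; exact norm_nonneg _
    calc γ * evnorm (S *ᵥ P *ᵥ X *ᵥ θ) ≤ γ * (normPD * (opNorm X * evnorm θ)) := by
          gcongr
          exact h1.trans (by gcongr)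
      _ = (γ * opNorm X * normPD) * evnorm θ := by ring
      _ ≤ (2 * (1 - ξ) * Real.sqrt η) * evnorm θ :=
          mul_le_mul_of_nonneg_right hcond (evnorm_nonneg _)
      _ = _ := by ring
  have hcb : evnorm c ≤ evnorm r / (2 * Real.sqrt η) := by
    refine (core X d hd hη r).trans ?_
    gcongr
    exact evnorm_diag_sqrt_le d hd hd1 r
  have hinj : Function.Injective (LinearMap.id - L : (Fin K → ℝ) →ₗ[ℝ] (Fin K → ℝ)) := by
    rw [injective_iff_map_eq_zero]
    intro θ hθ
    have h : θ = L θ := by simpa [sub_eq_zero] using hθ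
    have h1 := hLb θ
    rw [← h] at h1
    apply evnorm_eq_zero
    nlinarith [evnorm_nonneg θ]
  have hsurj := LinearMap.injective_iff_surjective.mp hinj
  have hiff : ∀ w, f w = w ↔ (LinearMap.id - L : (Fin K → ℝ) →ₗ[ℝ] (Fin K → ℝ)) w = c := by
    intro w
    rw [hfL, LinearMap.sub_apply, LinearMap.id_apply, sub_eq_iff_eq_add]
    exact eq_comm
  refine ⟨?_, ?_⟩
  · obtain ⟨w, hw⟩ := hsurj c
    refine ⟨w, (hiff w).mpr hw, fun y hy => hinj ?_⟩
    rw [hw]; exact (hiff y).mp hy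
  · intro w hw
    have h1 : evnorm w ≤ evnorm c + evnorm (L w) := by
      conv_lhs => rw [← hw, hfL]
      exact evnorm_add_le _ _
    have h2 := hLb w
    have h3 : ξ * evnorm w ≤ evnorm r / (2 * Real.sqrt η) := by linarith
    rw [le_div_iff₀ (by positivity)] at h3 ⊢
    linarith
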